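/- arXiv:2207.03278 — 2 statements merged into one kernel-verified Lean document; each statement's English description precedes it below -/
import Mathlib

section
/- For a finite-dimensional real vector space V of dimension n, the Koszul complex given by contraction with the Euler vector field is exact: for each k with 1 ≤ k ≤ n-1, if a smooth section φ of Λ^k V* over V satisfies ι_E φ = 0 (where E = x^i ∂_{x^i} is the Euler vector field), then φ = ι_E ψ for some smooth section ψ of Λ^{k+1} V*. -/
open MeasureTheory Topology Set in
theorem koszul_contDiff_integral_nat.{u} {V : Type u} [NormedAddCommGroup V] [NormedSpace ℝ V]
    [FiniteDimensional ℝ V] (n : ℕ) :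
    ∀ (F : Type u) [NormedAddCommGroup F] [NormedSpace ℝ F]
      (f : V → ℝ → F), ContDiff ℝ n (Function.uncurry f) →
      ContDiff ℝ n (fun x => ∫ t in (0:ℝ)..1, f x t) := by
  induction n with
  | zero =>
    intro F _ _ f hf
    have hf' := hf.continuous
    exact contDiff_zero.2
      (intervalIntegral.continuous_parametric_intervalIntegral_of_continuous' hf' 0 1)
  | succ n ih =>
    intro F _ _ f hf
    push_cast at hf ⊢
    have hfc := hf.continuous
    have hfd : Differentiable ℝ (Function.uncurry f) := hf.differentiable (by simp)
    have hD : ContDiff ℝ n (fderiv ℝ (Function.uncurry f)) := hf.fderiv_right le_rfl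
    let g : V → ℝ → V →L[ℝ] F := fun x t =>
      (fderiv ℝ (Function.uncurry f) (x, t)).comp (ContinuousLinearMap.inl ℝ V ℝ)
    have hg : ContDiff ℝ n (Function.uncurry g) := by
      have : Function.uncurry g = fun p => (fderiv ℝ (Function.uncurry f) p).comp
        (ContinuousLinearMap.inl ℝ V ℝ) := by ext ⟨x, t⟩; rfl
      rw [this]
      exact hD.clm_comp contDiff_const
    have hgc : Continuous (Function.uncurry g) := hg.continuous
    rw [contDiff_succ_iff_hasFDerivAt]
    refine ⟨fun x => ∫ t in (0:ℝ)..1, g x t, ih _ g hg, fun x₀ => ?_⟩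
    have hK : IsCompact (Metric.closedBall x₀ 1 ×ˢ Icc (0:ℝ) 1) :=
      (isCompact_closedBall x₀ 1).prod isCompact_Icc
    obtain ⟨C, hC⟩ := hK.exists_bound_of_continuousOn hgc.continuousOn
    refine intervalIntegral.hasFDerivAt_integral_of_dominated_of_fderiv_le
      (bound := fun _ => C) (Metric.closedBall_mem_nhds x₀ one_pos) ?_ ?_ ?_ ?_ ?_ ?_
    · refine Filter.Eventually.of_forall fun x => ?_
      exact (hfc.comp (by fun_prop : Continuous fun t : ℝ => (x, t))).aestronglyMeasurable
    · exact (hfc.comp (by fun_prop : Continuous fun t : ℝ => (x₀, t))).intervalIntegrable _ _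
    · exact (hgc.comp (by fun_prop : Continuous fun t : ℝ => (x₀, t))).aestronglyMeasurable
    · refine Filter.Eventually.of_forall fun t ht x hx => ?_
      rw [uIoc_of_le zero_le_one] at ht
      exact hC (x, t) ⟨hx, ht.1.le, ht.2⟩
    · exact intervalIntegrable_const
    · refine Filter.Eventually.of_forall fun t ht x hx => ?_
      have h1 : HasFDerivAt (fun e : V => (e, t)) (ContinuousLinearMap.inl ℝ V ℝ) x :=
        hasFDerivAt_prodMk_left x t
      exact HasFDerivAt.comp (g := Function.uncurry f) x (hfd (x, t)).hasFDerivAt h1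

theorem koszul_contDiff_integral.{u} {V F : Type u} [NormedAddCommGroup V] [NormedSpace ℝ V]
    [FiniteDimensional ℝ V] [NormedAddCommGroup F] [NormedSpace ℝ F]
      (f : V → ℝ → F) (hf : ContDiff ℝ (⊤ : ℕ∞) (Function.uncurry f)) :
      ContDiff ℝ (⊤ : ℕ∞) (fun x => ∫ t in (0:ℝ)..1, f x t) := by
  rw [contDiff_infty]
  intro n
  exact koszul_contDiff_integral_nat n F f (hf.of_le (by exact_mod_cast le_top))

theorem koszul_alternatizeCLM {V : Type*} [NormedAddCommGroup V] [NormedSpace ℝ V] (m : ℕ) :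
    ∃ A : ContinuousMultilinearMap ℝ (fun _ : Fin m => V) ℝ →L[ℝ] V [⋀^Fin m]→L[ℝ] ℝ,
      ∀ f, A f = ContinuousMultilinearMap.alternatization f := by
  let L : ContinuousMultilinearMap ℝ (fun _ : Fin m => V) ℝ →ₗ[ℝ] V [⋀^Fin m]→L[ℝ] ℝ :=
    { toFun := fun f => ContinuousMultilinearMap.alternatization f
      map_add' := fun f g => map_add _ f g
      map_smul' := fun c f => by
        ext v
        simp [ContinuousMultilinearMap.alternatization_apply_apply,
          Finset.mul_sum, Units.smul_def, mul_left_comm] }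
  refine ⟨L.mkContinuous (Fintype.card (Equiv.Perm (Fin m))) fun f => ?_, fun f => rfl⟩
  refine ContinuousAlternatingMap.opNorm_le_bound _ (by positivity) fun v => ?_
  change ‖ContinuousMultilinearMap.alternatization f v‖ ≤ _
  rw [ContinuousMultilinearMap.alternatization_apply_apply]
  refine (norm_sum_le _ _).trans ?_
  have : ∀ σ ∈ (Finset.univ : Finset (Equiv.Perm (Fin m))),
      ‖Equiv.Perm.sign σ • f (v ∘ σ)‖ ≤ ‖f‖ * ∏ i, ‖v i‖ := by
    intro σ _
    have h1 : ‖Equiv.Perm.sign σ • f (v ∘ σ)‖ = ‖f (v ∘ σ)‖ := by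
      rcases Int.units_eq_one_or (Equiv.Perm.sign σ) with h | h <;> simp [h]
    rw [h1]
    refine (f.le_opNorm _).trans_eq ?_
    congr 1
    exact Equiv.prod_comp σ (fun i => ‖v i‖)
  refine (Finset.sum_le_sum this).trans_eq ?_
  simp [mul_assoc]

/-- Cartan formula with kernel hypothesis. -/
theorem koszul_cartan {V : Type*} [NormedAddCommGroup V] [NormedSpace ℝ V] (k : ℕ)
    (ω : V → V [⋀^Fin (k + 1)]→L[ℝ] ℝ) (hω : Differentiable ℝ ω)
    (hker : ∀ (x : V) (v : Fin k → V), ω x (Fin.cons x v) = 0) (x : V) (v : Fin (k + 1) → V) :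
    extDeriv ω x (Fin.cons x v) = fderiv ℝ ω x x v + (k + 1) * ω x v := by
  have key : ∀ (w : V) (u : Fin k → V),
      fderiv ℝ ω x w (Fin.cons x u) = - ω x (Fin.cons w u) := by
    intro w u
    have h1 : HasDerivAt (fun t : ℝ => ω (x + t • w)) (fderiv ℝ ω x w) 0 := by
      have := (hω x).hasFDerivAt.hasLineDerivAt w
      exact this
    have e : ∀ t : ℝ, ω (x + t • w) (Fin.cons x u) + t * ω (x + t • w) (Fin.cons w u) = 0 := by
      intro t
      rw [← hker (x + t • w) u]
      have := (ω (x + t • w)).toMultilinearMap.cons_add u x (t • w)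
      have h2 := (ω (x + t • w)).toMultilinearMap.cons_smul u t w
      simp only [smul_eq_mul] at h2
      erw [this, h2]
      rfl
    have a1 : HasDerivAt (fun t : ℝ => ω (x + t • w) (Fin.cons x u))
        (fderiv ℝ ω x w (Fin.cons x u)) 0 :=
      (ContinuousAlternatingMap.apply ℝ V ℝ (Fin.cons x u)).hasFDerivAt.comp_hasDerivAt (0:ℝ) h1
    have a2 : HasDerivAt (fun t : ℝ => ω (x + t • w) (Fin.cons w u))
        (fderiv ℝ ω x w (Fin.cons w u)) 0 :=
      (ContinuousAlternatingMap.apply ℝ V ℝ (Fin.cons w u)).hasFDerivAt.comp_hasDerivAt (0:ℝ) h1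
    have a3 := a1.add ((hasDerivAt_id (0:ℝ)).mul a2)
    have a4 : HasDerivAt (fun _ : ℝ => (0:ℝ)) 0 0 := hasDerivAt_const _ _
    have a5 := a3.unique (a4.congr_of_eventuallyEq (Filter.Eventually.of_forall fun t => e t))
    simp at a5
    linarith
  rw [extDeriv, ContinuousAlternatingMap.alternatizeUncurryFin_apply, Fin.sum_univ_succ]
  have : ∀ j : Fin (k + 1), (-1 : ℤ) ^ (j.succ : ℕ) • fderiv ℝ ω x
      ((Fin.cons x v : Fin (k + 2) → V) j.succ) (j.succ.removeNth (Fin.cons x v : Fin (k + 2) → V))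
      = ω x v := by
    intro j
    have r : j.succ.removeNth (Fin.cons x v : Fin (k + 2) → V) = Fin.cons x (j.removeNth v) := by
      ext i
      refine Fin.cases ?_ (fun i => ?_) i
      · simp [Fin.removeNth]
      · simp [Fin.removeNth]
    rw [r, Fin.cons_succ, key]
    have := (ω x).map_insertNth j (v j) (j.removeNth v)
    rw [Fin.insertNth_self_removeNth] at this
    rw [this, Matrix.vecCons]
    simp [pow_succ]
  simp_all

/-- The Koszul complex on a finite-dimensional real vector space `V`, given by
contraction of (smooth sections of) `Λ^k V*` with the Euler vector field, is exact in
degrees `1 ≤ k ≤ n - 1`.  Here `Λ^k V*` is encoded as the space of continuous multilinear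
maps `V^k → ℝ` that are alternating, and contraction with the Euler vector field at the
point `x` inserts `x` into the first slot. -/
theorem koszul_contraction_euler_exact
    {V : Type*} [NormedAddCommGroup V] [NormedSpace ℝ V] [FiniteDimensional ℝ V]
    (n : ℕ) (hn : Module.finrank ℝ V = n) (k : ℕ) (hk : k + 1 ≤ n - 1)
    (φ : V → ContinuousMultilinearMap ℝ (fun _ : Fin (k + 1) => V) ℝ)
    (hφalt : ∀ (x : V) (v : Fin (k + 1) → V) (i j : Fin (k + 1)),
      v i = v j → i ≠ j → φ x v = 0)
    (hφsmooth : ContDiff ℝ (⊤ : ℕ∞) φ)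
    (hker : ∀ (x : V) (v : Fin k → V), φ x (Fin.cons x v) = 0) :
    ∃ ψ : V → ContinuousMultilinearMap ℝ (fun _ : Fin (k + 2) => V) ℝ,
      ContDiff ℝ (⊤ : ℕ∞) ψ ∧
      (∀ (x : V) (v : Fin (k + 2) → V) (i j : Fin (k + 2)),
        v i = v j → i ≠ j → ψ x v = 0) ∧
      (∀ (x : V) (v : Fin (k + 1) → V), φ x v = ψ x (Fin.cons x v)) := by
  obtain ⟨A, hA⟩ := koszul_alternatizeCLM (V := V) (k + 1)
  let ω : V → V [⋀^Fin (k + 1)]→L[ℝ] ℝ := fun x => ((Nat.factorial (k + 1) : ℝ)⁻¹) • A (φ x)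
  have hωφ : ∀ x v, ω x v = φ x v := by
    intro x v
    let a : V [⋀^Fin (k + 1)]→ₗ[ℝ] ℝ :=
      { (φ x).toMultilinearMap with
        map_eq_zero_of_eq' := fun v i j h hij => hφalt x v i j h hij }
    have ha : ∀ v, φ x v = a v := fun v => rfl
    have h1 : ∀ σ : Equiv.Perm (Fin (k + 1)), Equiv.Perm.sign σ • φ x (v ∘ σ) = φ x v := by
      intro σ
      rw [ha, ha, a.map_perm, smul_smul, Int.units_mul_self, one_smul]
    change ((Nat.factorial (k + 1) : ℝ)⁻¹) • (A (φ x)) v = _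
    rw [hA, ContinuousMultilinearMap.alternatization_apply_apply, Finset.sum_congr rfl
      (fun σ _ => h1 σ), Finset.sum_const, Finset.card_univ, Fintype.card_perm, Fintype.card_fin,
      nsmul_eq_mul, smul_eq_mul, inv_mul_cancel_left₀]
    exact_mod_cast Nat.factorial_ne_zero _
  have hωs : ContDiff ℝ (⊤ : ℕ∞) ω := (A.contDiff.comp hφsmooth).const_smul _
  have hωd : Differentiable ℝ ω := hωs.differentiable (by simp)
  have hωk : ∀ (x : V) (v : Fin k → V), ω x (Fin.cons x v) = 0 := fun x v => by
    rw [hωφ, hker]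
  have hcart := koszul_cartan k ω hωd hωk
  have hext : ContDiff ℝ (⊤ : ℕ∞) (extDeriv ω) :=
    (ContinuousAlternatingMap.alternatizeUncurryFinCLM ℝ V ℝ).contDiff.comp
      (hωs.fderiv_right (by simp))
  let f : V → ℝ → V [⋀^Fin (k + 2)]→L[ℝ] ℝ := fun x t => t ^ (k + 1) • extDeriv ω (t • x)
  have hf : ContDiff ℝ (⊤ : ℕ∞) (Function.uncurry f) := by
    change ContDiff ℝ (⊤ : ℕ∞) fun p : V × ℝ => p.2 ^ (k + 1) • extDeriv ω (p.2 • p.1)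
    exact (contDiff_snd.pow _).smul (hext.comp (contDiff_snd.smul contDiff_fst))
  let Ψ : V → V [⋀^Fin (k + 2)]→L[ℝ] ℝ := fun x => ∫ t in (0:ℝ)..1, f x t
  have hΨ : ContDiff ℝ (⊤ : ℕ∞) Ψ := koszul_contDiff_integral f hf
  refine ⟨fun x => (Ψ x).toContinuousMultilinearMap, ?_, ?_, ?_⟩
  · exact (ContinuousAlternatingMap.toContinuousMultilinearMapLI
      (𝕜 := ℝ) (E := V) (F := ℝ) (ι := Fin (k + 2))).contDiff.comp hΨ
  · intro x v i j h hij
    exact (Ψ x).map_eq_zero_of_eq v h hij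
  · intro x v
    change φ x v = Ψ x (Fin.cons x v)
    have hfx : Continuous (f x) :=
      hf.continuous.comp (by fun_prop : Continuous fun t : ℝ => (x, t))
    have h1 : Ψ x (Fin.cons x v) = ∫ t in (0:ℝ)..1, f x t (Fin.cons x v) :=
      ((ContinuousAlternatingMap.apply ℝ V ℝ (Fin.cons x v)).intervalIntegral_comp_comm
        (hfx.intervalIntegrable 0 1)).symm
    have hd : ∀ t : ℝ, HasDerivAt (fun t : ℝ => t ^ (k + 1) * ω (t • x) v)
        (f x t (Fin.cons x v)) t := by
      intro t
      have b0 : HasDerivAt (fun t : ℝ => t • x) x t := by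
        simpa using (hasDerivAt_id t).smul_const x
      have b1 : HasDerivAt (fun t : ℝ => ω (t • x)) (fderiv ℝ ω (t • x) x) t :=
        (hωd (t • x)).hasFDerivAt.comp_hasDerivAt t b0
      have b2 : HasDerivAt (fun t : ℝ => ω (t • x) v) (fderiv ℝ ω (t • x) x v) t :=
        (ContinuousAlternatingMap.apply ℝ V ℝ v).hasFDerivAt.comp_hasDerivAt t b1
      have b3 := (hasDerivAt_pow (k + 1) t).mul b2
      refine b3.congr_deriv ?_
      have c := hcart (t • x) v
      have c2 := (extDeriv ω (t • x)).toMultilinearMap.cons_smul v t x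
      have c3 : extDeriv ω (t • x) (Fin.cons (t • x) v) =
        t * extDeriv ω (t • x) (Fin.cons x v) := c2
      rw [c3] at c
      have c4 : fderiv ℝ ω (t • x) (t • x) v = t * fderiv ℝ ω (t • x) x v := by
        rw [map_smul]; rfl
      rw [c4] at c
      change _ = t ^ (k + 1) * extDeriv ω (t • x) (Fin.cons x v)
      simp only [Nat.add_sub_cancel]
      push_cast
      linear_combination (-t ^ k) * c
    have h2 := intervalIntegral.integral_eq_sub_of_hasDerivAt (fun t _ => hd t)
      (((ContinuousAlternatingMap.apply ℝ V ℝ (Fin.cons x v)).continuous.comp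
        hfx).intervalIntegrable 0 1)
    rw [h1, h2]
    simp [hωφ]
end

section
/- For a 4-dimensional symplectic vector space (V,ω), the space of sp(V,ω)-equivariant linear maps from Λ²V* ⊗ Λ²V* to Λ³V* ⊗ V is 5-dimensional. -/
variable {V : Type*} [AddCommGroup V] [Module ℝ V]

/-- The natural (tensor/derivation) action of `g ∈ gl(V)` on `(k+1)`-forms:
`(g·α)(v₁,…) = −Σᵢ α(v₁,…,g vᵢ,…)`, realized via alternatization. -/
noncomputable def formAct {k : ℕ} (g : V →ₗ[ℝ] V) :
    (V [⋀^Fin (k + 1)]→ₗ[ℝ] ℝ) →ₗ[ℝ] (V [⋀^Fin (k + 1)]→ₗ[ℝ] ℝ) where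
  toFun α := -(((Nat.factorial k : ℝ))⁻¹ •
    MultilinearMap.alternatization
      ((MultilinearMap.compLinearMapₗ
          (fun j : Fin (k + 1) => if j = 0 then g else LinearMap.id))
        α.toMultilinearMap))
  map_add' α β := by
    show -(((Nat.factorial k : ℝ))⁻¹ • MultilinearMap.alternatization
        ((MultilinearMap.compLinearMapₗ (fun j : Fin (k + 1) => if j = 0 then g else LinearMap.id))
          (α.toMultilinearMap + β.toMultilinearMap))) = _
    rw [map_add, map_add, smul_add, neg_add]
  map_smul' c α := by
    have h2 : ∀ m : MultilinearMap ℝ (fun _ : Fin (k + 1) => V) ℝ,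
        MultilinearMap.alternatization (c • m) = c • MultilinearMap.alternatization m := by
      intro m
      ext v
      simp [MultilinearMap.alternatization_apply, Finset.mul_sum, mul_smul_comm,
        MultilinearMap.smul_apply]
    show -(((Nat.factorial k : ℝ))⁻¹ • MultilinearMap.alternatization
        ((MultilinearMap.compLinearMapₗ (fun j : Fin (k + 1) => if j = 0 then g else LinearMap.id))
          (c • α.toMultilinearMap))) = _
    rw [map_smul, h2]
    show -(((Nat.factorial k : ℝ))⁻¹ • c • _) = c • -(((Nat.factorial k : ℝ))⁻¹ • _)
    rw [smul_comm, smul_neg]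

/-- Membership in the symplectic Lie algebra `sp(V,ω)`. -/
def IsSp (ω : V →ₗ[ℝ] V →ₗ[ℝ] ℝ) (A : Module.End ℝ V) : Prop :=
  ∀ x y : V, ω (A x) y + ω x (A y) = 0

/-- The induced action of `gl(V)` on `Λ²V* ⊗ Λ²V*`. -/
noncomputable def actTwoTwo (A : Module.End ℝ V) :
    TensorProduct ℝ (V [⋀^Fin 2]→ₗ[ℝ] ℝ) (V [⋀^Fin 2]→ₗ[ℝ] ℝ) →ₗ[ℝ]
      TensorProduct ℝ (V [⋀^Fin 2]→ₗ[ℝ] ℝ) (V [⋀^Fin 2]→ₗ[ℝ] ℝ) :=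
  LinearMap.rTensor _ (formAct (k := 1) A) + LinearMap.lTensor _ (formAct (k := 1) A)

/-- The induced action of `gl(V)` on `Λ³V* ⊗ V`. -/
noncomputable def actThreeV (A : Module.End ℝ V) :
    TensorProduct ℝ (V [⋀^Fin 3]→ₗ[ℝ] ℝ) V →ₗ[ℝ]
      TensorProduct ℝ (V [⋀^Fin 3]→ₗ[ℝ] ℝ) V :=
  LinearMap.rTensor _ (formAct (k := 2) A) + LinearMap.lTensor _ A

/-- A linear map `Λ²V* ⊗ Λ²V* → Λ³V* ⊗ V` is `sp(V,ω)`-equivariant. -/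
def IsEquivariantHom (ω : V →ₗ[ℝ] V →ₗ[ℝ] ℝ)
    (f : TensorProduct ℝ (V [⋀^Fin 2]→ₗ[ℝ] ℝ) (V [⋀^Fin 2]→ₗ[ℝ] ℝ) →ₗ[ℝ]
        TensorProduct ℝ (V [⋀^Fin 3]→ₗ[ℝ] ℝ) V) : Prop :=
  ∀ A : Module.End ℝ V, IsSp ω A → f ∘ₗ actTwoTwo A = actThreeV A ∘ₗ f

abbrev M4 := Matrix (Fin 4) (Fin 4) ℝ

/-- The standard symplectic matrix. -/
def J4 : M4 := !![0,0,1,0; 0,0,0,1; -1,0,0,0; 0,-1,0,0]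

/-- Matrices self-adjoint for `J4`: the model of two-forms. -/
def IsS (a : M4) : Prop := a.transpose * J4 = J4 * a

/-- Matrices in the symplectic Lie algebra. -/
def IsA (A : M4) : Prop := A.transpose * J4 = J4 * (-A)

def sMat (p q r s m n : ℝ) : M4 := !![p,q,0,m; r,s,-m,0; 0,n,p,r; -n,0,q,s]

def glMat (p q r s : ℝ) : M4 := !![p,q,0,0; r,s,0,0; 0,0,-p,-r; 0,0,-q,-s]
def loMat (u v w : ℝ) : M4 := !![0,0,0,0; 0,0,0,0; u,v,0,0; v,w,0,0]
def upMat (u v w : ℝ) : M4 := !![0,0,u,v; 0,0,v,w; 0,0,0,0; 0,0,0,0]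

def matE : M4 := sMat 0 0 0 0 1 0
def matF : M4 := sMat 0 0 0 0 0 1

lemma isS_sMat (p q r s m n : ℝ) : IsS (sMat p q r s m n) := by
  unfold IsS sMat J4
  ext i j
  fin_cases i <;> fin_cases j <;> simp [Matrix.mul_apply, Fin.sum_univ_four]

lemma isA_gl (p q r s : ℝ) : IsA (glMat p q r s) := by
  unfold IsA glMat J4
  ext i j
  fin_cases i <;> fin_cases j <;> simp [Matrix.mul_apply, Fin.sum_univ_four]

lemma isA_lo (u v w : ℝ) : IsA (loMat u v w) := by
  unfold IsA loMat J4
  ext i j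
  fin_cases i <;> fin_cases j <;> simp [Matrix.mul_apply, Fin.sum_univ_four]

lemma isA_up (u v w : ℝ) : IsA (upMat u v w) := by
  unfold IsA upMat J4
  ext i j
  fin_cases i <;> fin_cases j <;> simp [Matrix.mul_apply, Fin.sum_univ_four]

lemma isS_one : IsS 1 := by simp [IsS]

lemma IsS.exists_eq {a : M4} (h : IsS a) : ∃ p q r s m n, a = sMat p q r s m n := by
  refine ⟨a 0 0, a 0 1, a 1 0, a 1 1, a 0 3, a 2 1, ?_⟩
  have H : ∀ i j, (a.transpose * J4) i j = (J4 * a) i j := fun i j => by rw [h]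
  simp only [Matrix.mul_apply, Fin.sum_univ_four, J4, Matrix.transpose_apply] at H
  have h00 := H 0 0; have h01 := H 0 1; have h02 := H 0 2; have h03 := H 0 3
  have h11 := H 1 1; have h12 := H 1 2; have h13 := H 1 3
  have h22 := H 2 2; have h23 := H 2 3; have h33 := H 3 3
  simp at h00 h01 h02 h03 h11 h12 h13 h22 h23 h33
  ext i j
  fin_cases i <;> fin_cases j <;> simp [sMat] <;> linarith

lemma IsS.comm {A a : M4} (hA : IsA A) (ha : IsS a) : IsS (A * a - a * A) := by
  unfold IsS IsA at *
  rw [Matrix.transpose_sub, Matrix.transpose_mul, Matrix.transpose_mul, Matrix.sub_mul,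
    Matrix.mul_assoc, hA, Matrix.mul_assoc, ha, ← Matrix.mul_assoc, ha, ← Matrix.mul_assoc, hA]
  noncomm_ring

/-- The general self-adjoint matrix in terms of generators. -/
lemma sMat_decomp_lo (p q r s m n : ℝ) : sMat p q r s m n =
    ((p + s) / 2) • (1 : M4) + m • matE + n • matF +
      (loMat r ((s - p) / 2) (-q) * matE - matE * loMat r ((s - p) / 2) (-q)) := by
  ext i j
  fin_cases i <;> fin_cases j <;>
    simp [sMat, matE, matF, loMat, Matrix.mul_apply, Fin.sum_univ_four, Matrix.one_apply] <;> ring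

lemma sMat_decomp_up (p q r s m n : ℝ) : sMat p q r s m n =
    ((p + s) / 2) • (1 : M4) + m • matE + n • matF +
      (upMat q ((s - p) / 2) (-r) * matF - matF * upMat q ((s - p) / 2) (-r)) := by
  ext i j
  fin_cases i <;> fin_cases j <;>
    simp [sMat, matE, matF, upMat, Matrix.mul_apply, Fin.sum_univ_four, Matrix.one_apply] <;> ring

lemma lo_comm_F (u v w : ℝ) : loMat u v w * matF - matF * loMat u v w = 0 := by
  ext i j
  fin_cases i <;> fin_cases j <;>
    simp [sMat, matF, loMat, Matrix.mul_apply, Fin.sum_univ_four]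

lemma F_eq : matF = (1/2 : ℝ) • (loMat 0 1 0 * (loMat 0 1 0 * matE - matE * loMat 0 1 0)
    - (loMat 0 1 0 * matE - matE * loMat 0 1 0) * loMat 0 1 0) := by
  ext i j
  fin_cases i <;> fin_cases j <;>
    simp [sMat, matE, matF, loMat, Matrix.mul_apply, Fin.sum_univ_four] <;> norm_num

lemma E_eq : matE = (1/2 : ℝ) • (upMat 0 1 0 * (upMat 0 1 0 * matF - matF * upMat 0 1 0)
    - (upMat 0 1 0 * matF - matF * upMat 0 1 0) * upMat 0 1 0) := by
  ext i j
  fin_cases i <;> fin_cases j <;>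
    simp [sMat, matE, matF, upMat, Matrix.mul_apply, Fin.sum_univ_four] <;> norm_num

lemma isS_E : IsS matE := isS_sMat ..
lemma isS_F : IsS matF := isS_sMat ..

def IsEqv (B : M4 →ₗ[ℝ] M4 →ₗ[ℝ] M4) : Prop :=
  ∀ A a b, IsA A → IsS a → IsS b →
    A * B a b - B a b * A = B (A * a - a * A) b + B a (A * b - b * A)

/-- A linear map on self-adjoint matrices commuting with the action vanishes if it
kills `1` and `matE`. -/
lemma lin_vanish (D : M4 →ₗ[ℝ] M4)
    (hD : ∀ A a, IsA A → IsS a → A * D a - D a * A = D (A * a - a * A))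
    (h1 : D 1 = 0) (hE : D matE = 0) : ∀ a, IsS a → D a = 0 := by
  have hZ : ∀ u v w, D (loMat u v w * matE - matE * loMat u v w) = 0 := fun u v w => by
    rw [← hD _ _ (isA_lo u v w) isS_E, hE]; simp
  have hF : D matF = 0 := by
    rw [F_eq, map_smul, ← hD _ _ (isA_lo _ _ _) (isS_E.comm (isA_lo _ _ _)), hZ]; simp
  intro a ha
  obtain ⟨p, q, r, s, m, n, rfl⟩ := ha.exists_eq
  rw [sMat_decomp_lo]
  simp only [map_add, map_smul, h1, hE, hF, hZ]; simp

lemma bil_vanish (D : M4 →ₗ[ℝ] M4 →ₗ[ℝ] M4) (hD : IsEqv D)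
    (h11 : D 1 1 = 0) (h1E : D 1 matE = 0) (hE1 : D matE 1 = 0) (hEF : D matE matF = 0) :
    ∀ a b, IsS a → IsS b → D a b = 0 := by
  have h1 : ∀ b, IsS b → D 1 b = 0 := by
    refine lin_vanish (D 1) ?_ h11 h1E
    intro A b hA hb
    rw [hD A 1 b hA isS_one hb]; simp
  have h2 : ∀ a, IsS a → D a 1 = 0 := by
    refine lin_vanish (D.flip 1) ?_ h11 hE1
    intro A b hA hb
    simp only [LinearMap.flip_apply]
    rw [hD A b 1 hA hb isS_one]; simp
  have hZF : ∀ u v w, D (loMat u v w * matE - matE * loMat u v w) matF = 0 := fun u v w => by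
    have := hD _ _ _ (isA_lo u v w) isS_E isS_F
    rw [lo_comm_F, hEF] at this
    simpa using this.symm
  have hFF : D matF matF = 0 := by
    have := hD _ _ _ (isA_lo 0 1 0) (isS_E.comm (isA_lo 0 1 0)) isS_F
    rw [lo_comm_F, hZF, map_zero, add_zero] at this
    have e : D matF matF = D ((1/2 : ℝ) • (loMat 0 1 0 * (loMat 0 1 0 * matE - matE * loMat 0 1 0)
        - (loMat 0 1 0 * matE - matE * loMat 0 1 0) * loMat 0 1 0)) matF := by rw [← F_eq]
    rw [e, map_smul, LinearMap.smul_apply, ← this]; simp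
  have haF : ∀ a, IsS a → D a matF = 0 := by
    intro a ha
    obtain ⟨p, q, r, s, m, n, rfl⟩ := ha.exists_eq
    rw [sMat_decomp_lo]
    simp only [map_add, map_smul, LinearMap.add_apply, LinearMap.smul_apply, h1 _ isS_F, hEF, hFF,
      hZF]
    simp
  have haZ : ∀ a, IsS a → ∀ u v w, D a (upMat u v w * matF - matF * upMat u v w) = 0 := by
    intro a ha u v w
    have := hD _ _ _ (isA_up u v w) ha isS_F
    rw [haF _ ha, haF _ (ha.comm (isA_up u v w))] at this
    simpa using this.symm
  have haE : ∀ a, IsS a → D a matE = 0 := by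
    intro a ha
    have := hD _ _ _ (isA_up 0 1 0) ha (isS_F.comm (isA_up 0 1 0))
    rw [haZ _ ha, haZ _ (ha.comm (isA_up 0 1 0))] at this
    rw [E_eq, map_smul]
    simp only [Matrix.mul_zero, Matrix.zero_mul, sub_zero, zero_add] at this
    rw [← this, smul_zero]
  intro a b ha hb
  obtain ⟨p, q, r, s, m, n, rfl⟩ := hb.exists_eq
  rw [sMat_decomp_up]
  simp only [map_add, map_smul, h2 _ ha, haE _ ha, haF _ ha, haZ _ ha]
  simp

/-- The five basic bilinear maps on any algebra `R` with trace functional `t`. -/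
noncomputable def five {R : Type*} [Ring R] [Algebra ℝ R] (t : R →ₗ[ℝ] ℝ) :
    Fin 5 → (R →ₗ[ℝ] R →ₗ[ℝ] R) :=
  ![LinearMap.mk₂ ℝ (fun a b => (t a * t b) • (1 : R))
      (by intros; simp [add_mul, add_smul]) (by intros; simp [mul_assoc, mul_smul])
      (by intros; simp [mul_add, add_smul])
      (by intros; simp only [map_smul, smul_eq_mul, ← mul_smul]; congr 1; ring),
    LinearMap.mk₂ ℝ (fun a b => (t (a * b)) • (1 : R))
      (by intros; simp [add_mul, add_smul]) (by intros; simp [mul_smul])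
      (by intros; simp [mul_add, add_smul]) (by intros; simp [mul_smul]),
    LinearMap.mk₂ ℝ (fun a b => t a • b)
      (by intros; simp [add_smul]) (by intros; simp [mul_smul])
      (by intros; simp) (by intros; simp only [← mul_smul]; congr 1; ring),
    LinearMap.mk₂ ℝ (fun a b => t b • a)
      (by intros; simp) (by intros; simp only [← mul_smul]; congr 1; ring)
      (by intros; simp [add_smul]) (by intros; simp [mul_smul]),
    LinearMap.mul ℝ R]

lemma sum_five {R : Type*} [Ring R] [Algebra ℝ R] (t : R →ₗ[ℝ] ℝ) (c : Fin 5 → ℝ) (a b : R) :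
    ∑ i, c i • five t i a b = c 0 • (t a * t b) • (1 : R) + c 1 • t (a * b) • (1 : R)
      + c 2 • t a • b + c 3 • t b • a + c 4 • (a * b) := by
  simp [Fin.sum_univ_five, five]

lemma five_equivariant {R : Type*} [Ring R] [Algebra ℝ R] (t : R →ₗ[ℝ] ℝ)
    (ht : ∀ a b, t (a * b) = t (b * a)) (i : Fin 5) (A a b : R) :
    A * five t i a b - five t i a b * A
      = five t i (A * a - a * A) b + five t i a (A * b - b * A) := by
  have h3 : t (A * (a * b)) = t (a * (b * A)) := by rw [ht, mul_assoc]
  fin_cases i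
  · simp [five, ht A]
  · simp [five, mul_sub, sub_mul, mul_assoc, h3]
    module
  · simp [five, ht A, smul_sub]
  · simp [five, ht A, smul_sub]
  · simp [five]; noncomm_ring

noncomputable abbrev tr4 : M4 →ₗ[ℝ] ℝ := Matrix.traceLinearMap (Fin 4) ℝ ℝ

lemma tr_E : tr4 matE = 0 := by simp [matE, sMat, Matrix.trace, Fin.sum_univ_four]
lemma tr_F : tr4 matF = 0 := by simp [matF, sMat, Matrix.trace, Fin.sum_univ_four]
lemma tr_one : tr4 1 = 4 := by simp
lemma EF_eq : matE * matF = !![-1,0,0,0;0,-1,0,0;0,0,0,0;0,0,0,0] := by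
  ext i j
  fin_cases i <;> fin_cases j <;>
    simp [sMat, matE, matF, Matrix.mul_apply, Fin.sum_univ_four]
lemma tr_EF : tr4 (matE * matF) = -2 := by
  rw [EF_eq]; simp [Matrix.trace, Fin.sum_univ_four]; norm_num

/-- Weight-zero vectors for gl(2). -/
lemma comm_gl (X : M4) (h : ∀ p q r s, glMat p q r s * X - X * glMat p q r s = 0) :
    X = !![X 0 0,0,0,0;0,X 0 0,0,0;0,0,X 2 2,0;0,0,0,X 2 2] := by
  have H : ∀ p q r s i j, (glMat p q r s * X - X * glMat p q r s) i j = 0 :=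
    fun p q r s i j => by rw [h]; rfl
  simp only [Matrix.sub_apply, Matrix.mul_apply, Fin.sum_univ_four, glMat] at H
  have a := H 1 0 0 0; have b := H 0 0 0 1; have c := H 0 1 0 0
  clear H
  ext i j
  have a' := a i j; have b' := b i j; have c01 := c 0 1; have c32 := c 3 2
  clear a b c
  fin_cases i <;> fin_cases j <;> simp at a' b' c01 c32 ⊢ <;> linarith

lemma weight_E (X : M4)
    (h : ∀ p q r s, glMat p q r s * X - X * glMat p q r s = (p + s) • X) :
    X = X 0 3 • matE := by
  have H : ∀ p q r s i j, (glMat p q r s * X - X * glMat p q r s) i j = (p + s) * X i j:=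
    fun p q r s i j => by rw [h]; rfl
  simp only [Matrix.sub_apply, Matrix.mul_apply, Fin.sum_univ_four, glMat] at H
  have a := H 1 0 0 0; have b := H 0 0 0 1; have c := H 0 1 0 0
  clear H
  ext i j
  have a' := a i j; have b' := b i j; have c01 := c 0 2
  clear a b c
  fin_cases i <;> fin_cases j <;> simp [matE, sMat] at a' b' c01 ⊢ <;> linarith

lemma comm_all (X : M4) (h : ∀ A, IsA A → A * X - X * A = 0) : X = X 0 0 • (1 : M4) := by
  have h1 := comm_gl X fun p q r s => h _ (isA_gl p q r s)
  have h2 := congrFun (congrFun (h _ (isA_up 1 0 0)) 0) 2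
  simp [Matrix.mul_apply, Fin.sum_univ_four, upMat, Matrix.vecMul, dotProduct] at h2
  conv_lhs => rw [h1]
  ext i j
  fin_cases i <;> fin_cases j <;> simp [Matrix.one_apply] <;> linarith

lemma gl_E (p q r s : ℝ) : glMat p q r s * matE - matE * glMat p q r s = (p + s) • matE := by
  ext i j
  fin_cases i <;> fin_cases j <;>
    simp [sMat, matE, glMat, Matrix.mul_apply, Fin.sum_univ_four] <;> ring

lemma gl_F (p q r s : ℝ) : glMat p q r s * matF - matF * glMat p q r s = (-(p + s)) • matF := by
  ext i j
  fin_cases i <;> fin_cases j <;>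
    simp [sMat, matF, glMat, Matrix.mul_apply, Fin.sum_univ_four] <;> ring

theorem core (B : M4 →ₗ[ℝ] M4 →ₗ[ℝ] M4) (hB : IsEqv B) :
    ∃ c : Fin 5 → ℝ, ∀ a b, IsS a → IsS b → B a b = ∑ i, c i • five tr4 i a b := by
  have h11 := comm_all (B 1 1) fun A hA => by
    rw [hB A 1 1 hA isS_one isS_one]; simp
  have h1E := weight_E (B 1 matE) fun p q r s => by
    rw [hB _ _ _ (isA_gl p q r s) isS_one isS_E, gl_E]; simp
  have hE1 := weight_E (B matE 1) fun p q r s => by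
    rw [hB _ _ _ (isA_gl p q r s) isS_E isS_one, gl_E]; simp
  have hEF := comm_gl (B matE matF) fun p q r s => by
    rw [hB _ _ _ (isA_gl p q r s) isS_E isS_F, gl_E, gl_F, map_smul, map_smul, LinearMap.smul_apply]; module
  set t := B 1 1 0 0
  set x := B 1 matE 0 3
  set y := B matE 1 0 3
  set p := B matE matF 0 0
  set q := B matE matF 2 2
  let c : Fin 5 → ℝ := ![(t - 4 * (-q/2) - (x - (q - p)) - (y - (q - p)) - (q - p)) / 16,
    -q/2, (x - (q - p)) / 4, (y - (q - p)) / 4, q - p]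
  let D : M4 →ₗ[ℝ] M4 →ₗ[ℝ] M4 := B - ∑ i, c i • five tr4 i
  have hDa : ∀ a b, D a b = B a b - ∑ i, c i • five tr4 i a b := by
    intro a b; simp [D, LinearMap.sum_apply]
  have hD : IsEqv D := by
    intro A a b hA ha hb
    have e1 := hB A a b hA ha hb
    have e2 : ∀ i, _ := fun i => five_equivariant tr4 (fun a b => Matrix.trace_mul_comm a b) i A a b
    rw [hDa, hDa, hDa, Matrix.mul_sub, Matrix.sub_mul, Finset.mul_sum, Finset.sum_mul]
    have e3 : ∑ i, A * (c i • five tr4 i a b) - ∑ i, (c i • five tr4 i a b) * A =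
        ∑ i, c i • five tr4 i (A * a - a * A) b + ∑ i, c i • five tr4 i a (A * b - b * A) := by
      rw [← Finset.sum_sub_distrib, ← Finset.sum_add_distrib]
      refine Finset.sum_congr rfl fun i _ => ?_
      rw [← smul_add, ← e2 i, smul_sub, Matrix.mul_smul, Matrix.smul_mul]
    rw [sub_sub_sub_comm, e1, e3]; abel
  refine ⟨c, fun a b ha hb => ?_⟩
  rw [← sub_eq_zero, ← hDa]
  refine bil_vanish D hD ?_ ?_ ?_ ?_ a b ha hb
  · rw [hDa, sum_five, h11]
    simp only [mul_one, tr_one, smul_smul, ← add_smul, ← sub_smul]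
    simp only [c]
    simp
    ring_nf
  · rw [hDa, sum_five, h1E]
    simp only [one_mul, tr_one, tr_E, smul_smul, ← add_smul, ← sub_smul, c]
    simp
    module
  · rw [hDa, sum_five, hE1]
    simp only [mul_one, tr_one, tr_E, smul_smul, ← add_smul, ← sub_smul, c]
    simp
    module
  · rw [hDa, sum_five, hEF]
    rw [tr_EF, tr_E, tr_F, EF_eq]
    simp only [c]
    ext i j
    fin_cases i <;> fin_cases j <;> simp [Matrix.one_apply] <;> ring

lemma five_indep (c : Fin 5 → ℝ) (h : ∀ a b, IsS a → IsS b → ∑ i, c i • five tr4 i a b = 0) :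
    c = 0 := by
  have k1 := h _ _ isS_one isS_one
  have k2 := h _ _ isS_one isS_E
  have k3 := h _ _ isS_E isS_one
  have k4 := h _ _ isS_E isS_F
  rw [sum_five] at k1 k2 k3 k4
  have k1 := congrFun (congrFun k1 0) 0
  have k2 := congrFun (congrFun k2 0) 3
  have k3 := congrFun (congrFun k3 0) 3
  have k40 := congrFun (congrFun k4 0) 0
  have k42 := congrFun (congrFun k4 2) 2
  rw [tr_EF, tr_E, tr_F, EF_eq] at k40 k42
  rw [tr_one, mul_one, tr_one] at k1
  rw [tr_one, one_mul, tr_E] at k2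
  rw [tr_one, mul_one, tr_E] at k3
  simp [matE, sMat] at k1 k2 k3 k40 k42
  ext i
  fin_cases i <;> simp <;> linarith

section Reduction

lemma alt_perm {n : ℕ} (α : V [⋀^Fin n]→ₗ[ℝ] ℝ) (σ : Equiv.Perm (Fin n)) (s : ℤˣ)
    (hs : Equiv.Perm.sign σ = s) (v w : Fin n → V) (h : ∀ i, v i = w (σ i)) :
    α v = s • α w := by
  have : v = w ∘ σ := funext h
  rw [this, α.map_perm, hs]

lemma formAct_two (A : Module.End ℝ V) (α : V [⋀^Fin 2]→ₗ[ℝ] ℝ) (x y : V) :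
    formAct (k := 1) A α ![x, y] = -(α ![A x, y] + α ![x, A y]) := by
  have hu : (Finset.univ : Finset (Equiv.Perm (Fin 2))) = {1, Equiv.swap 0 1} := by decide
  simp only [formAct, LinearMap.coe_mk, AddHom.coe_mk, AlternatingMap.neg_apply,
    AlternatingMap.smul_apply, MultilinearMap.alternatization_apply]
  rw [hu, Finset.sum_pair (by decide)]
  simp only [MultilinearMap.domDomCongr_apply, MultilinearMap.compLinearMapₗ_apply,
    MultilinearMap.compLinearMap_apply, AlternatingMap.coe_multilinearMap]
  have t2 : α (fun i : Fin 2 => (if i = 0 then A else LinearMap.id)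
      (![x, y] (Equiv.swap 0 1 i))) = (-1 : ℤˣ) • α ![x, A y] :=
    alt_perm α (Equiv.swap 0 1) (-1) (by decide) _ _
      (by intro i; fin_cases i <;> simp [Equiv.swap_apply_def])
  have e : (fun i : Fin 2 => (if i = 0 then A else LinearMap.id)
      (![x, y] ((1 : Equiv.Perm (Fin 2)) i))) = ![A x, y] := by
    ext i; fin_cases i <;> simp
  rw [e, t2]
  simp

lemma formAct_three (A : Module.End ℝ V) (α : V [⋀^Fin 3]→ₗ[ℝ] ℝ) (x y z : V) :
    formAct (k := 2) A α ![x, y, z] = -(α ![A x, y, z] + α ![x, A y, z] + α ![x, y, A z]) := by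
  let c : Equiv.Perm (Fin 3) := Equiv.swap 0 1 * Equiv.swap 1 2
  let d : Equiv.Perm (Fin 3) := Equiv.swap 1 2 * Equiv.swap 0 1
  have hu : (Finset.univ : Finset (Equiv.Perm (Fin 3))) =
    {1, Equiv.swap 0 1, Equiv.swap 0 2, Equiv.swap 1 2, c, d} := by decide
  simp only [formAct, LinearMap.coe_mk, AddHom.coe_mk, AlternatingMap.neg_apply,
    AlternatingMap.smul_apply, MultilinearMap.alternatization_apply]
  rw [hu, Finset.sum_insert (by decide), Finset.sum_insert (by decide),
    Finset.sum_insert (by decide), Finset.sum_insert (by decide), Finset.sum_pair (by decide)]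
  simp only [MultilinearMap.domDomCongr_apply, MultilinearMap.compLinearMapₗ_apply,
    MultilinearMap.compLinearMap_apply, AlternatingMap.coe_multilinearMap]
  have t1 : α (fun i : Fin 3 => (if i = 0 then A else LinearMap.id)
      (![x, y, z] ((1 : Equiv.Perm (Fin 3)) i))) = (1 : ℤˣ) • α ![A x, y, z] :=
    alt_perm α 1 1 (by decide) _ _ (by intro i; fin_cases i <;> simp)
  have t2 : α (fun i : Fin 3 => (if i = 0 then A else LinearMap.id)
      (![x, y, z] (Equiv.swap 0 1 i))) = (-1 : ℤˣ) • α ![x, A y, z] :=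
    alt_perm α (Equiv.swap 0 1) (-1) (by decide) _ _
      (by intro i; fin_cases i <;> simp [Equiv.swap_apply_def])
  have t3 : α (fun i : Fin 3 => (if i = 0 then A else LinearMap.id)
      (![x, y, z] (Equiv.swap 0 2 i))) = (-1 : ℤˣ) • α ![x, y, A z] :=
    alt_perm α (Equiv.swap 0 2) (-1) (by decide) _ _
      (by intro i; fin_cases i <;> simp [Equiv.swap_apply_def])
  have t4 : α (fun i : Fin 3 => (if i = 0 then A else LinearMap.id)
      (![x, y, z] (Equiv.swap 1 2 i))) = (-1 : ℤˣ) • α ![A x, y, z] :=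
    alt_perm α (Equiv.swap 1 2) (-1) (by decide) _ _
      (by intro i; fin_cases i <;> simp [Equiv.swap_apply_def])
  have t5 : α (fun i : Fin 3 => (if i = 0 then A else LinearMap.id)
      (![x, y, z] (c i))) = (1 : ℤˣ) • α ![x, A y, z] :=
    alt_perm α c 1 (by decide) _ _ (by intro i; fin_cases i <;> simp [c, Equiv.swap_apply_def])
  have t6 : α (fun i : Fin 3 => (if i = 0 then A else LinearMap.id)
      (![x, y, z] (d i))) = (1 : ℤˣ) • α ![x, y, A z] :=
    alt_perm α d 1 (by decide) _ _ (by intro i; fin_cases i <;> simp [d, Equiv.swap_apply_def])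
  have hc : Equiv.Perm.sign c = 1 := by decide
  have hd : Equiv.Perm.sign d = 1 := by decide
  rw [t1, t2, t3, t4, t5, t6, hc, hd, Equiv.Perm.sign_swap (by decide),
    Equiv.Perm.sign_swap (by decide), Equiv.Perm.sign_swap (by decide)]
  simp
  ring

lemma exists_symplectic_basis [FiniteDimensional ℝ V] (hdim : Module.finrank ℝ V = 4)
    (ω : V →ₗ[ℝ] V →ₗ[ℝ] ℝ)
    (hskew : ∀ x y : V, ω x y = -ω y x)
    (hnondeg : ∀ x : V, (∀ y : V, ω x y = 0) → x = 0) :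
    ∃ b : Module.Basis (Fin 4) ℝ V, ∀ i j, ω (b i) (b j) = J4 i j := by
  have h0 : ∀ x, ω x x = 0 := fun x => by have := hskew x x; linarith
  have hex : ∀ x : V, x ≠ 0 → ∃ y, ω x y = 1 := by
    intro x hx
    by_contra! h
    apply hx
    apply hnondeg
    intro y
    by_contra hy
    apply h ((ω x y)⁻¹ • y)
    simp [hy]
  have : Nontrivial V := Module.nontrivial_of_finrank_pos (R := ℝ) (by omega)
  obtain ⟨e1, he1⟩ := exists_ne (0 : V)
  obtain ⟨f1, hf1⟩ := hex e1 he1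
  have hker : LinearMap.ker ((ω e1).prod (ω f1)) ≠ ⊥ := by
    apply LinearMap.ker_ne_bot_of_finrank_lt
    simp [hdim]
  obtain ⟨e2, he2, he2'⟩ := Submodule.exists_mem_ne_zero_of_ne_bot hker
  replace he2 : ω e1 e2 = 0 ∧ ω f1 e2 = 0 := by
    have h := LinearMap.mem_ker.mp he2
    exact ⟨congrArg Prod.fst h, congrArg Prod.snd h⟩
  obtain ⟨z, hz⟩ := hex e2 he2'
  obtain ⟨f2, hf2⟩ : ∃ f2, f2 = z - (ω e1 z) • f1 + (ω f1 z) • e1 := ⟨_, rfl⟩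
  have a1 : ω f1 e1 = -1 := by rw [hskew, hf1]
  have a2 : ω e2 e1 = 0 := by rw [hskew, he2.1, neg_zero]
  have a3 : ω e2 f1 = 0 := by rw [hskew, he2.2, neg_zero]
  have a4 : ω e1 f2 = 0 := by simp [hf2, h0, hf1]
  have a5 : ω f1 f2 = 0 := by simp [hf2, h0, a1]
  have a6 : ω e2 f2 = 1 := by simp [hf2, a2, a3, hz]
  have a7 : ω f2 e1 = 0 := by rw [hskew, a4, neg_zero]
  have a8 : ω f2 f1 = 0 := by rw [hskew, a5, neg_zero]
  have a9 : ω f2 e2 = -1 := by rw [hskew, a6]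
  have hv : ∀ i j, ω (![e1, e2, f1, f2] i) (![e1, e2, f1, f2] j) = J4 i j := by
    intro i j
    fin_cases i <;> fin_cases j <;> simp [J4, h0, hf1, he2, a1, a2, a3, a4, a5, a6, a7, a8, a9]
  have hli : LinearIndependent ℝ ![e1, e2, f1, f2] := by
    rw [Fintype.linearIndependent_iff]
    intro g hg
    have key : ∀ j, ∑ i, g i * J4 i j = 0 := by
      intro j
      have := congrArg (fun t => ω t (![e1, e2, f1, f2] j)) hg
      simp only [map_sum, map_smul, LinearMap.sum_apply, LinearMap.smul_apply, hv, smul_eq_mul,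
        map_zero, LinearMap.zero_apply] at this
      exact this
    have k0 := key 0; have k1 := key 1; have k2 := key 2; have k3 := key 3
    simp [Fin.sum_univ_four, J4] at k0 k1 k2 k3
    intro i
    fin_cases i <;> simpa
  refine ⟨basisOfLinearIndependentOfCardEqFinrank hli (by simp [hdim]), ?_⟩
  intro i j
  simpa using hv i j

/-- The duality isomorphism given by a nondegenerate form. -/
noncomputable def omegaEquiv [FiniteDimensional ℝ V] (ω : V →ₗ[ℝ] V →ₗ[ℝ] ℝ)
    (hnondeg : ∀ x : V, (∀ y : V, ω x y = 0) → x = 0) : V ≃ₗ[ℝ] Module.Dual ℝ V :=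
  LinearEquiv.ofInjectiveOfFinrankEq ω
    (by
      rw [← LinearMap.ker_eq_bot, LinearMap.ker_eq_bot']
      intro x hx
      exact hnondeg x fun y => by rw [hx]; rfl)
    (Subspace.dual_finrank_eq).symm

lemma omegaEquiv_apply [FiniteDimensional ℝ V] (ω : V →ₗ[ℝ] V →ₗ[ℝ] ℝ)
    (hnondeg : ∀ x : V, (∀ y : V, ω x y = 0) → x = 0) (x : V) :
    omegaEquiv ω hnondeg x = ω x := rfl

lemma alt_swap (α : V [⋀^Fin 2]→ₗ[ℝ] ℝ) (x y : V) : α ![x, y] = -α ![y, x] := by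
  have := α.map_swap ![y, x] (i := 0) (j := 1) (by decide)
  rw [← this]; congr 1; ext i; fin_cases i <;> simp

lemma alt_add (α : V [⋀^Fin 2]→ₗ[ℝ] ℝ) (x x' y : V) :
    α ![x + x', y] = α ![x, y] + α ![x', y] := α.map_vecCons_add ![y] x x'

lemma alt_smul (α : V [⋀^Fin 2]→ₗ[ℝ] ℝ) (c : ℝ) (x y : V) :
    α ![c • x, y] = c * α ![x, y] := α.map_vecCons_smul ![y] c x

/-- A two-form as a bilinear form. -/
noncomputable def formBil : (V [⋀^Fin 2]→ₗ[ℝ] ℝ) →ₗ[ℝ] V →ₗ[ℝ] Module.Dual ℝ V where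
  toFun α := LinearMap.mk₂ ℝ (fun x y => α ![x, y]) (alt_add α) (alt_smul α)
    (by intro x y y'; rw [alt_swap, alt_add, alt_swap α y, alt_swap α y']; ring)
    (by intro c x y; rw [alt_swap, alt_smul, alt_swap α y]; simp)
  map_add' α β := by ext; rfl
  map_smul' c α := by ext; rfl

lemma formBil_apply (α : V [⋀^Fin 2]→ₗ[ℝ] ℝ) (x y : V) : formBil α x y = α ![x, y] := rfl

lemma formBil_injective : Function.Injective (formBil (V := V)) := by
  intro α β h
  ext v
  have e : v = ![v 0, v 1] := by ext i; fin_cases i <;> rfl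
  rw [e, ← formBil_apply, ← formBil_apply, h]

/-- An alternating bilinear form as a two-form. -/
def mkForm (B : V →ₗ[ℝ] V →ₗ[ℝ] ℝ) (hB : ∀ x, B x x = 0) : V [⋀^Fin 2]→ₗ[ℝ] ℝ where
  toFun v := B (v 0) (v 1)
  map_update_add' v i x y := by
    rename_i inst
    obtain rfl : inst = instDecidableEqFin 2 := Subsingleton.elim _ _
    fin_cases i <;> simp [Function.update]
  map_update_smul' v i c x := by
    rename_i inst
    obtain rfl : inst = instDecidableEqFin 2 := Subsingleton.elim _ _
    fin_cases i <;> simp [Function.update]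
  map_eq_zero_of_eq' v i j h hij := by
    have : v 0 = v 1 := by
      fin_cases i <;> fin_cases j <;> simp_all
    simp [this, hB]

/-- The three-form `ω(u,·) ∧ ω`. -/
def kapForm (ω : V →ₗ[ℝ] V →ₗ[ℝ] ℝ) (h0 : ∀ x, ω x x = 0) (hskew : ∀ x y : V, ω x y = -ω y x)
    (u : V) : V [⋀^Fin 3]→ₗ[ℝ] ℝ where
  toFun v := ω u (v 0) * ω (v 1) (v 2) + ω u (v 1) * ω (v 2) (v 0) + ω u (v 2) * ω (v 0) (v 1)
  map_update_add' v i x y := by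
    rename_i inst
    obtain rfl : inst = instDecidableEqFin 3 := Subsingleton.elim _ _
    fin_cases i <;> simp [Function.update] <;> ring
  map_update_smul' v i c x := by
    rename_i inst
    obtain rfl : inst = instDecidableEqFin 3 := Subsingleton.elim _ _
    fin_cases i <;> simp [Function.update] <;> ring
  map_eq_zero_of_eq' v i j h hij := by
    have key : v 0 = v 1 ∨ v 0 = v 2 ∨ v 1 = v 2 := by
      fin_cases i <;> fin_cases j <;> simp at h hij <;> simp [h]
    rcases key with h | h | h
    · simp only [h, h0]; rw [hskew (v 2) (v 1)]; ring
    · simp only [h, h0]; rw [hskew (v 2) (v 1)]; ring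
    · simp only [h, h0]; rw [hskew (v 2) (v 0)]; ring

/-- `u ↦ ω(u,·) ∧ ω`, linear version. -/
def kap (ω : V →ₗ[ℝ] V →ₗ[ℝ] ℝ) (h0 : ∀ x, ω x x = 0) (hskew : ∀ x y : V, ω x y = -ω y x) :
    V →ₗ[ℝ] V [⋀^Fin 3]→ₗ[ℝ] ℝ where
  toFun := kapForm ω h0 hskew
  map_add' u v := by ext; simp [kapForm]; ring
  map_smul' c u := by ext; simp [kapForm]; ring

lemma kap_apply (ω : V →ₗ[ℝ] V →ₗ[ℝ] ℝ) (h0 : ∀ x, ω x x = 0)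
    (hskew : ∀ x y : V, ω x y = -ω y x) (u : V) (v : Fin 3 → V) : kap ω h0 hskew u v =
      ω u (v 0) * ω (v 1) (v 2) + ω u (v 1) * ω (v 2) (v 0) + ω u (v 2) * ω (v 0) (v 1) := rfl

lemma kap_equivariant (ω : V →ₗ[ℝ] V →ₗ[ℝ] ℝ) (h0 : ∀ x, ω x x = 0)
    (hskew : ∀ x y : V, ω x y = -ω y x) (A : Module.End ℝ V) (hA : IsSp ω A) (u : V) :
    kap ω h0 hskew (A u) = formAct (k := 2) A (kap ω h0 hskew u) := by
  ext v
  have e : v = ![v 0, v 1, v 2] := by ext i; fin_cases i <;> rfl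
  rw [e, formAct_three]
  simp only [kap_apply]
  have hA' : ∀ x y, ω x (A y) = - ω (A x) y := fun x y => by have := hA x y; linarith
  simp [hA']
  have t : ∀ x y, ω (A x) y = ω (A y) x := fun x y => by rw [hskew, hA', neg_neg]
  rw [t (v 2) (v 0)]
  ring

lemma kap_injective (ω : V →ₗ[ℝ] V →ₗ[ℝ] ℝ) (h0 : ∀ x, ω x x = 0)
    (hskew : ∀ x y : V, ω x y = -ω y x) (b : Module.Basis (Fin 4) ℝ V)
    (hb : ∀ i j, ω (b i) (b j) = J4 i j) 
    (hnondeg : ∀ x : V, (∀ y : V, ω x y = 0) → x = 0) :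
    Function.Injective (kap ω h0 hskew) := by
  rw [← LinearMap.ker_eq_bot, LinearMap.ker_eq_bot']
  intro u hu
  have H : ∀ i j k, kap ω h0 hskew u ![b i, b j, b k] = 0 := fun i j k => by rw [hu]; rfl
  simp only [kap_apply] at H
  apply hnondeg
  have hz : ω u = 0 := by
    apply b.ext
    have q0 := H 0 1 3; have q1 := H 1 0 2; have q2 := H 2 1 3; have q3 := H 3 0 2
    simp [hb, J4] at q0 q1 q2 q3
    intro i
    fin_cases i <;> simpa
  intro y; rw [hz]; rfl

lemma finrank_three [FiniteDimensional ℝ V] (hdim : Module.finrank ℝ V = 4) :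
    Module.finrank ℝ (V [⋀^Fin 3]→ₗ[ℝ] ℝ) = 4 := by
  rw [(exteriorPower.alternatingMapLinearEquiv (R := ℝ) (M := V) (N := ℝ) (n := 3)).finrank_eq]
  have := Subspace.dual_finrank_eq (K := ℝ) (V := ⋀[ℝ]^3 V)
  rw [exteriorPower.finrank_eq, hdim] at this
  exact this

end Reduction

section Assembly

open TensorProduct

/-- The matrix model of three-forms tensor vectors. -/
lemma exists_target [FiniteDimensional ℝ V] (hdim : Module.finrank ℝ V = 4)
    (ω : V →ₗ[ℝ] V →ₗ[ℝ] ℝ)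
    (hskew : ∀ x y : V, ω x y = -ω y x)
    (hnondeg : ∀ x : V, (∀ y : V, ω x y = 0) → x = 0)
    (b : Module.Basis (Fin 4) ℝ V) (hb : ∀ i j, ω (b i) (b j) = J4 i j) :
    ∃ T : ((V [⋀^Fin 3]→ₗ[ℝ] ℝ) ⊗[ℝ] V) ≃ₗ[ℝ] M4, ∀ A : Module.End ℝ V, IsSp ω A → ∀ n,
      T (actThreeV A n) = LinearMap.toMatrix b b A * T n - T n * LinearMap.toMatrix b b A := by
  have h0 : ∀ x, ω x x = 0 := fun x => by have := hskew x x; linarith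
  let κ : V ≃ₗ[ℝ] (V [⋀^Fin 3]→ₗ[ℝ] ℝ) :=
    haveI : FiniteDimensional ℝ (V [⋀^Fin 3]→ₗ[ℝ] ℝ) :=
      FiniteDimensional.of_finrank_pos (by rw [finrank_three hdim]; norm_num)
    LinearEquiv.ofInjectiveOfFinrankEq (kap ω h0 hskew) (kap_injective ω h0 hskew b hb hnondeg)
      (by rw [finrank_three hdim, hdim])
  have hκ : ∀ u, κ u = kap ω h0 hskew u := fun _ => rfl
  let T1 : (V ⊗[ℝ] V) ≃ₗ[ℝ] Module.End ℝ V :=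
    (TensorProduct.congr (omegaEquiv ω hnondeg) (LinearEquiv.refl ℝ V)).trans
      (dualTensorHomEquivOfBasis b)
  have hT1 : ∀ u v x, T1 (u ⊗ₜ v) x = ω u x • v := by
    intro u v x
    simp [T1, omegaEquiv_apply]
  let T2 := (TensorProduct.congr κ.symm (LinearEquiv.refl ℝ V)).trans T1
  have hT2 : ∀ u v x, T2 (κ u ⊗ₜ v) x = ω u x • v := by
    intro u v x
    simp [T2, hT1]
  refine ⟨T2.trans (LinearMap.toMatrix b b), fun A hA n => ?_⟩
  simp only [LinearEquiv.trans_apply]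
  rw [← LinearMap.toMatrix_mul, ← LinearMap.toMatrix_mul, ← map_sub]
  congr 1
  induction n using TensorProduct.induction_on with
  | zero => simp
  | add x y hx hy => rw [map_add, map_add, hx, hy, map_add]; noncomm_ring
  | tmul η v =>
    obtain ⟨u, rfl⟩ := κ.surjective η
    ext x
    have hk : formAct (k := 2) A (κ u) = κ (A u) := by
      rw [hκ, hκ, kap_equivariant ω h0 hskew A hA]
    simp only [actThreeV, LinearMap.add_apply, LinearMap.rTensor_tmul, LinearMap.lTensor_tmul, hk,
      map_add, hT2, LinearMap.sub_apply, Module.End.mul_apply, map_smul]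
    have := hA u x
    rw [show ω (A u) x = -ω u (A x) by linarith]
    module

/-- The matrix model of two-forms. -/
lemma exists_source [FiniteDimensional ℝ V]
    (ω : V →ₗ[ℝ] V →ₗ[ℝ] ℝ)
    (hskew : ∀ x y : V, ω x y = -ω y x)
    (hnondeg : ∀ x : V, (∀ y : V, ω x y = 0) → x = 0)
    (b : Module.Basis (Fin 4) ℝ V) (hb : ∀ i j, ω (b i) (b j) = J4 i j) :
    ∃ P : (V [⋀^Fin 2]→ₗ[ℝ] ℝ) →ₗ[ℝ] M4, Function.Injective P ∧
      (∀ a, IsS a ↔ ∃ α, P α = a) ∧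
      (∀ A, IsA A → IsSp ω (Matrix.toLin b b A)) ∧
      ∀ A : Module.End ℝ V, IsSp ω A → ∀ α,
      P (formAct (k := 1) A α) =
        LinearMap.toMatrix b b A * P α - P α * LinearMap.toMatrix b b A := by
  have hω : ω = Matrix.toLinearMap₂ b b J4 := by
    apply (LinearMap.toMatrix₂ b b).injective
    ext i j
    rw [LinearMap.toMatrix₂_toLinearMap₂, LinearMap.toMatrix₂_apply, hb]
  have hadj : ∀ A A' : M4, A.transpose * J4 = J4 * A' ↔
      ∀ x y, ω (Matrix.toLin b b A x) y = ω x (Matrix.toLin b b A' y) := by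
    intro A A'
    have := isAdjointPair_toLinearMap₂ (b₁ := b) (b₂ := b) (J := J4) (J' := J4) (A := A) (A' := A')
    rw [← hω] at this
    exact this.symm
  let Φ : (V [⋀^Fin 2]→ₗ[ℝ] ℝ) →ₗ[ℝ] Module.End ℝ V :=
    (LinearMap.llcomp ℝ V _ V (omegaEquiv ω hnondeg).symm.toLinearMap) ∘ₗ formBil
  have hΦ : ∀ α x y, ω (Φ α x) y = α ![x, y] := by
    intro α x y
    rw [← omegaEquiv_apply ω hnondeg]
    simp [Φ, formBil_apply]
  have huniq : ∀ u v : V, (∀ y, ω u y = ω v y) → u = v := by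
    intro u v h
    rw [← sub_eq_zero]
    apply hnondeg
    intro y
    rw [map_sub, LinearMap.sub_apply, h, sub_self]
  have hΦinj : Function.Injective Φ := by
    intro α β h
    apply formBil_injective
    ext x y
    rw [formBil_apply, formBil_apply, ← hΦ, h, hΦ]
  refine ⟨(LinearMap.toMatrix b b).toLinearMap ∘ₗ Φ, ?_, ?_, ?_, ?_⟩
  · exact (LinearMap.toMatrix b b).injective.comp hΦinj
  · intro a
    unfold IsS
    rw [hadj]
    constructor
    · intro h
      refine ⟨mkForm (ω ∘ₗ Matrix.toLin b b a) ?_, ?_⟩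
      · intro x
        have h1 := h x x
        rw [hskew x] at h1
        simp only [LinearMap.comp_apply]
        linarith
      · rw [LinearMap.comp_apply, LinearEquiv.coe_coe, ← (Matrix.toLin b b).injective.eq_iff,
          Matrix.toLin_toMatrix]
        ext x
        apply huniq
        intro y
        rw [hΦ]
        rfl
    · rintro ⟨α, rfl⟩ x y
      simp only [LinearMap.comp_apply, LinearEquiv.coe_coe, Matrix.toLin_toMatrix]
      rw [hΦ, hskew, hΦ, alt_swap]
  · intro A hA x y
    rw [(hadj A (-A)).mp hA x y]
    simp
  · intro A hA α
    simp only [LinearMap.comp_apply, LinearEquiv.coe_coe]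
    rw [← LinearMap.toMatrix_mul, ← LinearMap.toMatrix_mul, ← map_sub]
    congr 1
    ext x
    apply huniq
    intro y
    have := hA (Φ α x) y
    rw [hΦ, formAct_two, LinearMap.sub_apply, map_sub, LinearMap.sub_apply, Module.End.mul_apply,
      Module.End.mul_apply, hΦ, ← hΦ α x]
    linarith

end Assembly

/-- for a 4-dimensional symplectic vector space `(V,ω)`, the space of
`sp(V,ω)`-equivariant linear maps `Λ²V* ⊗ Λ²V* → Λ³V* ⊗ V` is 5-dimensional: there are
five linearly independent equivariant maps spanning all equivariant maps. -/
theorem finrank_equivariantHoms_eq_five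
    [FiniteDimensional ℝ V] (hdim : Module.finrank ℝ V = 4)
    (ω : V →ₗ[ℝ] V →ₗ[ℝ] ℝ)
    (hskew : ∀ x y : V, ω x y = -ω y x)
    (hnondeg : ∀ x : V, (∀ y : V, ω x y = 0) → x = 0) :
    ∃ f : Fin 5 →
        (TensorProduct ℝ (V [⋀^Fin 2]→ₗ[ℝ] ℝ) (V [⋀^Fin 2]→ₗ[ℝ] ℝ) →ₗ[ℝ]
          TensorProduct ℝ (V [⋀^Fin 3]→ₗ[ℝ] ℝ) V),
      (∀ i, IsEquivariantHom ω (f i)) ∧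
      LinearIndependent ℝ f ∧
      ∀ g, IsEquivariantHom ω g → g ∈ Submodule.span ℝ (Set.range f) := by
  obtain ⟨b, hb⟩ := exists_symplectic_basis hdim ω hskew hnondeg
  obtain ⟨T, hT⟩ := exists_target hdim ω hskew hnondeg b hb
  obtain ⟨P, hPinj, hPS, hSp, hP⟩ := exists_source ω hskew hnondeg b hb
  have hf : ∀ (c : Fin 5 → ℝ) α β, T ((∑ i, c i • (T.symm.toLinearMap ∘ₗ
      TensorProduct.lift ((five tr4 i).compl₁₂ P P))) (TensorProduct.tmul ℝ α β)) =
      ∑ i, c i • five tr4 i (P α) (P β) := by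
    intro c α β
    simp [LinearMap.sum_apply, map_sum]
  refine ⟨fun i => T.symm.toLinearMap ∘ₗ TensorProduct.lift ((five tr4 i).compl₁₂ P P),
    ?_, ?_, ?_⟩
  · intro i A hA
    apply TensorProduct.ext'
    intro α β
    apply T.injective
    rw [LinearMap.comp_apply, LinearMap.comp_apply (actThreeV A), hT A hA]
    simp only [actTwoTwo, LinearMap.add_apply, LinearMap.rTensor_tmul, LinearMap.lTensor_tmul,
      map_add, LinearMap.comp_apply, LinearEquiv.coe_coe, LinearEquiv.apply_symm_apply,
      TensorProduct.lift.tmul, LinearMap.compl₁₂_apply, hP A hA]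
    rw [five_equivariant tr4 (fun a b => Matrix.trace_mul_comm a b)]
  · rw [Fintype.linearIndependent_iffₛ]
    intro c d hcd
    have : c - d = 0 := by
      apply five_indep
      intro a a' ha ha'
      obtain ⟨α, rfl⟩ := (hPS a).mp ha
      obtain ⟨β, rfl⟩ := (hPS a').mp ha'
      simp only [Pi.sub_apply, sub_smul, Finset.sum_sub_distrib]
      rw [← hf, ← hf, hcd, sub_self]
    intro i
    exact sub_eq_zero.mp (congrFun this i)
  · intro g hg
    obtain ⟨Q, hQ⟩ := P.exists_leftInverse_of_injective (LinearMap.ker_eq_bot.mpr hPinj)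
    have hQ' : ∀ α, Q (P α) = α := fun α => LinearMap.congr_fun hQ α
    let B : M4 →ₗ[ℝ] M4 →ₗ[ℝ] M4 :=
      ((TensorProduct.mk ℝ _ _).compl₁₂ Q Q).compr₂ (T.toLinearMap ∘ₗ g)
    have hB : ∀ α β, B (P α) (P β) = T (g (TensorProduct.tmul ℝ α β)) := by
      intro α β
      simp [B, hQ']
    have hBe : IsEqv B := by
      intro A a a' hA ha ha'
      obtain ⟨α, rfl⟩ := (hPS a).mp ha
      obtain ⟨β, rfl⟩ := (hPS a').mp ha'
      have h1 := hP _ (hSp A hA)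
      have h2 := hT _ (hSp A hA)
      rw [LinearMap.toMatrix_toLin] at h1 h2
      rw [← h1, ← h1, hB, hB, hB, ← h2, ← LinearMap.comp_apply, ← hg _ (hSp A hA),
        LinearMap.comp_apply, ← map_add, ← map_add]
      rfl
    obtain ⟨c, hc⟩ := core B hBe
    rw [Submodule.mem_span_range_iff_exists_fun]
    refine ⟨c, ?_⟩
    apply TensorProduct.ext'
    intro α β
    apply T.injective
    rw [hf, ← hB, hc _ _ ((hPS _).mpr ⟨α, rfl⟩) ((hPS _).mpr ⟨β, rfl⟩)]
end
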